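/- Let D be a finite digraph and ~ an equivalence relation on its edge set such that equivalent edges have equal source. Define the out-splitting digraph OS(D, ~) with vertices the ~-classes [e] and edges the pairs (e₁, [e₂]) with t(e₁) = s(e₂), where (e₁,[e₂]) goes from [e₁] to [e₂]. Then the standard map f : OS(D,~) → D defined by ([e])f_V = s(e) and ((e₁,[e₂]))f_E = e₁ is a well-defined digraph homomorphism and a folding. -/

import Mathlib

structure Digraph' where
  V : Type
  E : Type
  s : E → V
  t : E → V

structure DHom (D₁ D₂ : Digraph') where
  vMap : D₁.V → D₂.V
  eMap : D₁.E → D₂.E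
  hs : ∀ e, D₂.s (eMap e) = vMap (D₁.s e)
  ht : ∀ e, D₂.t (eMap e) = vMap (D₁.t e)

def BiWalk (D : Digraph') : Type :=
  { f : ℤ → D.E // ∀ i : ℤ, D.t (f i) = D.s (f (i + 1)) }

def biMap {D₁ D₂ : Digraph'} (φ : DHom D₁ D₂) (w : BiWalk D₁) : BiWalk D₂ :=
  ⟨fun i => φ.eMap (w.1 i), fun i => by rw [φ.ht, φ.hs, w.2 i]⟩

structure FwdWalk (D : Digraph') where
  ed : ℕ → D.E
  chain : ∀ i : ℕ, D.t (ed i) = D.s (ed (i + 1))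

structure BwdWalk (D : Digraph') where
  ed : ℕ → D.E
  chain : ∀ i : ℕ, D.t (ed (i + 1)) = D.s (ed i)

/-- UDAF digraph condition: for each vertex, the number of infinite forwards walks
from it and of infinite backwards walks to it are each `≠ 1`. -/
def IsUDAF (D : Digraph') : Prop :=
  (∀ v : D.V, ¬∃! p : FwdWalk D, D.s (p.ed 0) = v) ∧
  (∀ v : D.V, ¬∃! p : BwdWalk D, D.t (p.ed 0) = v)

/-- The out-splitting digraph `OS(D, ∼)` of `D` with respect to an equivalence
relation on edges for which equivalent edges have equal source. -/
def OSdigraph (D : Digraph') (r : Setoid D.E)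
    (hsrc : ∀ e₁ e₂, r.r e₁ e₂ → D.s e₁ = D.s e₂) : Digraph' where
  V := Quotient r
  E := { p : D.E × Quotient r // D.t p.1 = Quotient.lift D.s hsrc p.2 }
  s p := Quotient.mk r p.1.1
  t p := p.1.2

/-- The standard folding of the out-splitting onto `D`. -/
def OSfold (D : Digraph') (r : Setoid D.E)
    (hsrc : ∀ e₁ e₂, r.r e₁ e₂ → D.s e₁ = D.s e₂) : DHom (OSdigraph D r hsrc) D where
  vMap := Quotient.lift D.s hsrc
  eMap p := p.1.1
  hs p := rfl
  ht p := p.2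

/-- The standard map from the out-splitting to `D` is a well-defined digraph
homomorphism (given by `[e] ↦ s(e)` on vertices and `(e₁,[e₂]) ↦ e₁` on edges)
and is a folding. -/
theorem stmt5 (D : Digraph') [Fintype D.V] [Fintype D.E] (r : Setoid D.E)
    (hsrc : ∀ e₁ e₂, r.r e₁ e₂ → D.s e₁ = D.s e₂) :
    (∀ e : D.E, (OSfold D r hsrc).vMap (Quotient.mk r e) = D.s e) ∧
    (∀ p, (OSfold D r hsrc).eMap p = p.1.1) ∧
    Function.Bijective (biMap (OSfold D r hsrc)) := by
  refine ⟨fun _ => rfl, fun _ => rfl, ?_, ?_⟩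
  · intro u w h
    have heq : ∀ i, (u.1 i).1.1 = (w.1 i).1.1 := fun i => congrFun (congrArg Subtype.val h) i
    have hu : ∀ i, (u.1 i).1.2 = Quotient.mk r (u.1 (i + 1)).1.1 := u.2
    have hw : ∀ i, (w.1 i).1.2 = Quotient.mk r (w.1 (i + 1)).1.1 := w.2
    refine Subtype.ext (funext fun i => Subtype.ext (Prod.ext (heq i) ?_))
    rw [hu, hw, heq]
  · intro w
    exact ⟨⟨fun i => ⟨(w.1 i, Quotient.mk r (w.1 (i + 1))), w.2 i⟩, fun _ => rfl⟩, rfl⟩
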